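/- Let y : D → ℕ be a counting function with coefficients c_α and let α ∈ L with associated level number s and strata counts n_{α,h}. Then for each h = 0, …, s−1, n_{α,h} = (#D/s) Σ_{k=0}^{s−1} c_{[−kα]} · ω_{[hk]}, where ω_j = exp(2πi j/s), [−kα] denotes the componentwise product of −k and α in L, and [hk] is hk mod s. -/

import Mathlib

open scoped BigOperators Classical

/-- The interaction term `X^α` on the full factorial design, where a design
point `ζ` is coded by its exponents: the `j`-th coordinate of the point is
`exp(2πi ζ_j / n_j)`, and `X^α(ζ) = ∏_j exp(2πi α_j ζ_j / n_j)`. -/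
noncomputable def Xterm (m : ℕ) (n : Fin m → ℕ) (α ζ : ∀ j, ZMod (n j)) : ℂ :=
  ∏ j, Complex.exp (2 * (Real.pi : ℂ) * Complex.I * ((α j).val : ℂ) * ((ζ j).val : ℂ) / (n j : ℂ))

/-- The coefficient `c_α = (1/#D) Σ_{ζ∈D} y(ζ)·conj(X^α(ζ))` of the counting
function `y` of a fraction. -/
noncomputable def coeff (m : ℕ) (n : Fin m → ℕ) [∀ j, NeZero (n j)]
    (y : (∀ j, ZMod (n j)) → ℕ) (α : ∀ j, ZMod (n j)) : ℂ :=
  (∏ j, (n j : ℂ))⁻¹ * ∑ ζ : ∀ j, ZMod (n j), (y ζ : ℂ) * (starRingEnd ℂ) (Xterm m n α ζ)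

/-- The level number `s` associated to the term `X^α`:
`s = lcm(s_1,…,s_m)` with `s_j = 1` if `α_j = 0` and `s_j = n_j / gcd(α_j, n_j)`
otherwise, so that `X^α` takes values in the `s`-th roots of unity `Ω_s`. -/
noncomputable def levelS (m : ℕ) (n : Fin m → ℕ) (α : ∀ j, ZMod (n j)) : ℕ :=
  Finset.univ.lcm (fun j => if α j = 0 then 1 else n j / Nat.gcd (α j).val (n j))

/-- The strata count `n_{α,h} = Σ_{ζ ∈ D_h^α} y(ζ)`, where
`D_h^α = {ζ ∈ D : conj(X^α(ζ)) = exp(2πi h/s)}` and `s = levelS m n α`. -/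
noncomputable def strataCount (m : ℕ) (n : Fin m → ℕ) [∀ j, NeZero (n j)]
    (y : (∀ j, ZMod (n j)) → ℕ) (α : ∀ j, ZMod (n j)) (h : ℕ) : ℕ :=
  ∑ ζ ∈ Finset.univ.filter (fun ζ => (starRingEnd ℂ) (Xterm m n α ζ) =
      Complex.exp (2 * (Real.pi : ℂ) * Complex.I * (h : ℂ) / (levelS m n α : ℂ))), y ζ

lemma Xterm_eq_prod_stdAddChar (m : ℕ) (n : Fin m → ℕ) [∀ j, NeZero (n j)]
    (α ζ : ∀ j, ZMod (n j)) :
    Xterm m n α ζ = ∏ j, ZMod.stdAddChar (α j * ζ j) := by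
  refine Finset.prod_congr rfl fun j _ => ?_
  have e : α j * ζ j = (((α j).val * (ζ j).val : ℕ) : ℤ) := by simp
  rw [e, ZMod.stdAddChar_coe]
  congr 1
  push_cast
  ring

lemma conj_Xterm_neg_natCast_mul (m : ℕ) (n : Fin m → ℕ) [∀ j, NeZero (n j)]
    (α ζ : ∀ j, ZMod (n j)) (k : ℕ) :
    (starRingEnd ℂ) (Xterm m n (fun j => -((k : ZMod (n j)) * α j)) ζ) = Xterm m n α ζ ^ k := by
  rw [Xterm_eq_prod_stdAddChar, Xterm_eq_prod_stdAddChar, map_prod, ← Finset.prod_pow]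
  refine Finset.prod_congr rfl fun j _ => ?_
  rw [← AddChar.map_neg_eq_conj, ← AddChar.map_nsmul_eq_pow, nsmul_eq_mul]
  congr 1
  ring

lemma levelS_mul_eq_zero (m : ℕ) (n : Fin m → ℕ) (α : ∀ j, ZMod (n j))
    [∀ j, NeZero (n j)] (j : Fin m) : (levelS m n α : ZMod (n j)) * α j = 0 := by
  by_cases hα : α j = 0
  · rw [hα, mul_zero]
  have hdvd : n j / Nat.gcd (α j).val (n j) ∣ levelS m n α := by
    have hj := Finset.dvd_lcm (f := fun j => if α j = 0 then 1 else
      n j / Nat.gcd (α j).val (n j)) (Finset.mem_univ j)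
    rwa [if_neg hα] at hj
  have hn : n j ∣ levelS m n α * (α j).val := by
    refine dvd_trans ?_ (mul_dvd_mul hdvd (Nat.gcd_dvd_left (α j).val (n j)))
    rw [Nat.div_mul_cancel (Nat.gcd_dvd_right _ _)]
  have := (ZMod.natCast_eq_zero_iff _ _).2 hn
  simpa using this

lemma Xterm_pow_levelS (m : ℕ) (n : Fin m → ℕ) [∀ j, NeZero (n j)]
    (α ζ : ∀ j, ZMod (n j)) : Xterm m n α ζ ^ levelS m n α = 1 := by
  rw [Xterm_eq_prod_stdAddChar, ← Finset.prod_pow]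
  refine Finset.prod_eq_one fun j _ => ?_
  rw [← AddChar.map_nsmul_eq_pow, nsmul_eq_mul, ← mul_assoc, levelS_mul_eq_zero, zero_mul,
    AddChar.map_zero_eq_one]

lemma conj_mul_self_of_pow_eq_one {s : ℕ} (hs : s ≠ 0) {z : ℂ} (hz : z ^ s = 1) :
    (starRingEnd ℂ) z * z = 1 := by
  rw [Complex.conj_mul', Complex.norm_eq_one_of_pow_eq_one hz hs]
  simp

lemma exp_mod_eq_pow {s : ℕ} (hs : s ≠ 0) (h k : ℕ) :
    Complex.exp (2 * (Real.pi : ℂ) * Complex.I * (((h * k) % s : ℕ) : ℂ) / (s : ℂ)) =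
      Complex.exp (2 * (Real.pi : ℂ) * Complex.I * (h : ℂ) / (s : ℂ)) ^ k := by
  have hζ := Complex.isPrimitiveRoot_exp s hs
  have hexp (a : ℕ) : Complex.exp (2 * (Real.pi : ℂ) * Complex.I * (a : ℂ) / (s : ℂ)) =
      Complex.exp (2 * (Real.pi : ℂ) * Complex.I / (s : ℂ)) ^ a := by
    rw [← Complex.exp_nat_mul]
    congr 1
    ring
  rw [hexp, hexp, ← pow_mul, ← pow_mod_orderOf _ (h * k), ← hζ.eq_orderOf]

lemma geom_sum_eq_ite {s : ℕ} {w : ℂ} (hw : w ^ s = 1) :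
    ∑ k ∈ Finset.range s, w ^ k = if w = 1 then (s : ℂ) else 0 := by
  split_ifs with h
  · simp [h]
  · rw [geom_sum_eq h, hw, sub_self, zero_div]

/-- `n_{α,h} = (#D/s) Σ_{k=0}^{s−1} c_{[−kα]} · ω_{[hk]}`, where `s` is the
level number of `X^α`, `ω_j = exp(2πi j/s)`, `[−kα]` is the componentwise
product of `−k` and `α` in `L`, and `[hk]` is `hk mod s`. -/
theorem strata_eq_sum_coeffs (m : ℕ) (hm : 1 ≤ m) (n : Fin m → ℕ) [∀ j, NeZero (n j)]
    (y : (∀ j, ZMod (n j)) → ℕ) (α : ∀ j, ZMod (n j)) (h : ℕ) (hh : h < levelS m n α) :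
    (strataCount m n y α h : ℂ) =
      ((∏ j, (n j : ℂ)) / (levelS m n α : ℂ)) *
        ∑ k ∈ Finset.range (levelS m n α),
          coeff m n y (fun j => -((k : ZMod (n j)) * α j)) *
            Complex.exp (2 * (Real.pi : ℂ) * Complex.I * (((h * k) % levelS m n α : ℕ) : ℂ) /
              (levelS m n α : ℂ)) := by
  have hs : levelS m n α ≠ 0 := by omega
  have hs' : (levelS m n α : ℂ) ≠ 0 := by exact_mod_cast hs
  have hD : (∏ j, (n j : ℂ)) ≠ 0 :=
    Finset.prod_ne_zero_iff.2 fun j _ => Nat.cast_ne_zero.2 (NeZero.ne (n j))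
  set ω := Complex.exp (2 * (Real.pi : ℂ) * Complex.I * (h : ℂ) / (levelS m n α : ℂ)) with hω
  have hωs : ω ^ levelS m n α = 1 := by
    rw [hω, ← exp_mod_eq_pow hs, Nat.mul_mod_left]
    simp
  have hsum (ζ : ∀ j, ZMod (n j)) :
      ∑ k ∈ Finset.range (levelS m n α), Xterm m n α ζ ^ k * ω ^ k =
        if (starRingEnd ℂ) (Xterm m n α ζ) = ω then (levelS m n α : ℂ) else 0 := by
    have hX := Xterm_pow_levelS m n α ζ
    have hconj := conj_mul_self_of_pow_eq_one hs hX
    have hX0 : Xterm m n α ζ ≠ 0 := right_ne_zero_of_mul_eq_one hconj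
    simp_rw [← mul_pow]
    rw [geom_sum_eq_ite (by rw [mul_pow, hX, hωs, one_mul])]
    refine if_congr ?_ rfl rfl
    rw [← hconj, mul_comm, mul_left_inj' hX0, eq_comm]
  simp_rw [exp_mod_eq_pow hs, ← hω, coeff, conj_Xterm_neg_natCast_mul, mul_assoc,
    ← Finset.mul_sum, Finset.sum_mul]
  rw [Finset.sum_comm]
  simp_rw [mul_assoc, ← Finset.mul_sum, hsum, mul_ite, mul_zero, ← Finset.sum_filter]
  rw [← Finset.sum_mul, strataCount, Nat.cast_sum, ← hω]
  field_simp
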